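/- arXiv:math/0409047 — 14 statements merged into one kernel-verified Lean document; each statement's English description precedes it below -/
import Mathlib

section
/- Let k ≥ 2 be an integer and let a > 0, b > 0 be real numbers with b ≤ ((k+1)/(k-1))². Then the equation a·x = ((1+x)/(b+x))^k has exactly one solution x ≥ 0. -/
/-- Derivative of `x ↦ x * ((b + x) / (1 + x)) ^ k`, in factored form. -/
lemma hasDerivAt_mul_div_pow (k : ℕ) (hk : 1 ≤ k) (b x : ℝ) (hx : 1 + x ≠ 0) :
    HasDerivAt (fun y : ℝ => y * ((b + y) / (1 + y)) ^ k)
      (((b + x) / (1 + x)) ^ (k - 1) / (1 + x) ^ 2 *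
        ((b + x) * (1 + x) + k * x * (1 - b))) x := by
  have h₁ : HasDerivAt (fun y : ℝ => b + y) 1 x := (hasDerivAt_id x).const_add b
  have h₂ : HasDerivAt (fun y : ℝ => 1 + y) 1 x := (hasDerivAt_id x).const_add 1
  refine ((hasDerivAt_id x).mul ((h₁.div h₂ hx).pow k)).congr_deriv ?_
  obtain ⟨m, rfl⟩ : ∃ m, k = m + 1 := ⟨k - 1, by omega⟩
  simp only [Nat.add_sub_cancel, Pi.pow_apply, Pi.div_apply, id, pow_succ]
  generalize ((b + x) / (1 + x)) ^ m = r
  field_simp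
  ring

/-- If `√b ≤ (k + 1) / (k - 1)`, the quadratic controlling the sign of the derivative is
positive away from `√b`. -/
lemma quadratic_pos {k s x : ℝ} (hs : 0 ≤ s) (hks : k * (s - 1) ≤ s + 1) (hx : 0 ≤ x)
    (hxs : x ≠ s) : 0 < (s ^ 2 + x) * (1 + x) + k * x * (1 - s ^ 2) := by
  have h₁ : 0 < (x - s) ^ 2 := by
    have := sub_ne_zero.mpr hxs
    positivity
  have h₂ : 0 ≤ x * (s + 1) * (s + 1 - k * (s - 1)) :=
    mul_nonneg (by positivity) (by linarith)
  linarith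

lemma strictMonoOn_mul_div_pow (k : ℕ) (hk : 1 ≤ k) {s : ℝ} (hs : 0 < s)
    (hks : (k : ℝ) * (s - 1) ≤ s + 1) :
    StrictMonoOn (fun y : ℝ => y * ((s ^ 2 + y) / (1 + y)) ^ k) (Set.Ici 0) := by
  have deriv_eq : ∀ x : ℝ, 0 ≤ x → _ := fun x hx =>
    hasDerivAt_mul_div_pow k hk (s ^ 2) x (by positivity)
  have pos : ∀ x : ℝ, 0 ≤ x → x ≠ s →
      0 < deriv (fun y : ℝ => y * ((s ^ 2 + y) / (1 + y)) ^ k) x := by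
    intro x hx hxs
    rw [(deriv_eq x hx).deriv]
    exact mul_pos (by positivity) (quadratic_pos hs.le hks hx hxs)
  have left : StrictMonoOn (fun y : ℝ => y * ((s ^ 2 + y) / (1 + y)) ^ k) (Set.Icc 0 s) := by
    refine strictMonoOn_of_deriv_pos (convex_Icc 0 s)
      (fun x hx => (deriv_eq x hx.1).continuousAt.continuousWithinAt) fun x hx => ?_
    rw [interior_Icc] at hx
    exact pos x hx.1.le hx.2.ne
  have right : StrictMonoOn (fun y : ℝ => y * ((s ^ 2 + y) / (1 + y)) ^ k) (Set.Ici s) := by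
    refine strictMonoOn_of_deriv_pos (convex_Ici s)
      (fun x hx => (deriv_eq x (hs.le.trans hx)).continuousAt.continuousWithinAt) fun x hx => ?_
    rw [interior_Ici] at hx
    exact pos x (hs.trans hx).le (ne_of_gt hx)
  rw [← Set.Icc_union_Ici_eq_Ici hs.le]
  exact left.union right (isGreatest_Icc hs.le) isLeast_Ici

lemma exists_mul_eq_div_pow (k : ℕ) {a b : ℝ} (ha : 0 < a) (hb : 0 < b) :
    ∃ x : ℝ, 0 ≤ x ∧ a * x = ((1 + x) / (b + x)) ^ k := by
  set M : ℝ := (1 / b + 1) ^ k / a with hM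
  have hM0 : 0 ≤ M := by positivity
  have cont : ContinuousOn (fun x : ℝ => a * x - ((1 + x) / (b + x)) ^ k) (Set.Icc 0 M) := by
    refine (by fun_prop : ContinuousOn (fun x : ℝ => a * x) _).sub (ContinuousOn.pow ?_ k)
    refine ContinuousOn.div (by fun_prop) (by fun_prop) fun x hx => ?_
    have := hx.1
    positivity
  have bound : ((1 + M) / (b + M)) ^ k ≤ a * M := by
    rw [hM, mul_div_cancel₀ _ ha.ne', ← hM]
    refine pow_le_pow_left₀ (by positivity) ?_ k
    rw [div_le_iff₀ (by positivity)]
    have : (1 / b + 1) * (b + M) = 1 + M + b + M / b := by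
      field_simp
      ring
    have : 0 ≤ M / b := by positivity
    linarith
  obtain ⟨x, hx, hx'⟩ := intermediate_value_Icc hM0 cont
    (show (0 : ℝ) ∈ Set.Icc _ _ from ⟨by
      have : 0 ≤ ((1 + 0) / (b + 0)) ^ k := by positivity
      simpa using this, sub_nonneg.mpr bound⟩)
  exact ⟨x, hx.1, sub_eq_zero.mp hx'⟩

/-- For k ≥ 2 and a > 0, 0 < b ≤ ((k+1)/(k-1))², the equation
a·x = ((1+x)/(b+x))^k has exactly one solution x ≥ 0. -/
theorem sos_unique_solution_small_b (k : ℕ) (hk : 2 ≤ k) (a b : ℝ)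
    (ha : 0 < a) (hb : 0 < b)
    (hb' : b ≤ (((k : ℝ) + 1) / ((k : ℝ) - 1)) ^ 2) :
    ∃! x : ℝ, 0 ≤ x ∧ a * x = ((1 + x) / (b + x)) ^ k := by
  obtain ⟨s, hs, rfl⟩ : ∃ s : ℝ, 0 < s ∧ b = s ^ 2 :=
    ⟨√b, Real.sqrt_pos.mpr hb, (Real.sq_sqrt hb.le).symm⟩
  have hk1 : (0 : ℝ) < k - 1 := by
    have : (2 : ℝ) ≤ k := by exact_mod_cast hk
    linarith
  have hks : (k : ℝ) * (s - 1) ≤ s + 1 := by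
    have := le_of_sq_le_sq hb' (by positivity)
    rw [le_div_iff₀ hk1] at this
    linarith
  have inv : ∀ x : ℝ, 0 ≤ x → a * x = ((1 + x) / (s ^ 2 + x)) ^ k →
      x * ((s ^ 2 + x) / (1 + x)) ^ k = 1 / a := by
    intro x hx h
    rw [eq_div_iff ha.ne', mul_right_comm, mul_comm x a, h, ← mul_pow]
    have h₁ : 1 + x ≠ 0 := by positivity
    have h₂ : s ^ 2 + x ≠ 0 := by positivity
    rw [div_mul_div_cancel₀ h₂, div_self h₁, one_pow]
  obtain ⟨x, hx, h⟩ := exists_mul_eq_div_pow k ha hb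
  refine ⟨x, ⟨hx, h⟩, fun y ⟨hy, h'⟩ => ?_⟩
  exact (strictMonoOn_mul_div_pow k (by omega) hs hks).injOn hy hx
    ((inv y hy h').trans (inv x hx h).symm)
end

section
/- Let k ≥ 2 be an integer and let b > ((k+1)/(k-1))² be a real number. Then the quadratic x² + (2 − (b−1)(k−1))x + b = 0 has two distinct positive real roots x₁ < x₂. Setting νᵢ = (1/xᵢ)·((1+xᵢ)/(b+xᵢ))^k for i = 1,2, and letting ν_min = min(ν₁,ν₂), ν_max = max(ν₁,ν₂), one has 0 < ν_min < ν_max, and for a > 0 the equation a·x = ((1+x)/(b+x))^k has exactly three solutions x ≥ 0 if ν_min < a < ν_max, and exactly two solutions x ≥ 0 if a = ν_min or a = ν_max. -/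
open Set

/-- The function `x ↦ (1 / x) * ((1 + x) / (b + x)) ^ k`, whose positive level sets are
the solution sets of `a * x = ((1 + x) / (b + x)) ^ k`. -/
noncomputable def sosRatio (k : ℕ) (b x : ℝ) : ℝ :=
  (1 / x) * ((1 + x) / (b + x)) ^ k

lemma ncard_level_set_of_anti_mono_anti {f : ℝ → ℝ} {x₁ x₂ a : ℝ} (h₁ : 0 < x₁) (h₁₂ : x₁ < x₂)
    (hc : ContinuousOn f (Ioi 0)) (hl : StrictAntiOn f (Ioc 0 x₁))
    (hm : StrictMonoOn f (Icc x₁ x₂)) (hr : StrictAntiOn f (Ici x₂))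
    (hlarge : ∃ y ∈ Ioc 0 x₁, a ≤ f y) (hsmall : ∃ z ∈ Ici x₂, f z ≤ a) :
    (f x₁ < a → a < f x₂ → {x | 0 < x ∧ f x = a}.ncard = 3) ∧
      (a = f x₁ ∨ a = f x₂ → {x | 0 < x ∧ f x = a}.ncard = 2) := by
  obtain ⟨y, hy, hya⟩ := hlarge
  obtain ⟨z, hz, hza⟩ := hsmall
  have hf : f x₁ < f x₂ := hm ⟨le_rfl, h₁₂.le⟩ ⟨h₁₂.le, le_rfl⟩ h₁₂
  have hleft : f x₁ ≤ a → ∃ u ∈ Ioc 0 x₁, f u = a := fun h ↦ by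
    obtain ⟨u, hu, rfl⟩ := intermediate_value_Icc' hy.2
      (hc.mono fun t ht ↦ hy.1.trans_le ht.1) ⟨h, hya⟩
    exact ⟨u, ⟨hy.1.trans_le hu.1, hu.2⟩, rfl⟩
  have hright : a ≤ f x₂ → ∃ u ∈ Ici x₂, f u = a := fun h ↦ by
    obtain ⟨u, hu, rfl⟩ := intermediate_value_Icc' hz
      (hc.mono fun t ht ↦ (h₁.trans h₁₂).trans_le ht.1) ⟨hza, h⟩
    exact ⟨u, hu.1, rfl⟩
  have hmid : f x₁ ≤ a → a ≤ f x₂ → ∃ u ∈ Icc x₁ x₂, f u = a := fun h h' ↦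
    intermediate_value_Icc h₁₂.le (hc.mono fun t ht ↦ h₁.trans_le ht.1) ⟨h, h'⟩
  have hset : ∀ u ∈ Ioc 0 x₁, ∀ v ∈ Icc x₁ x₂, ∀ w ∈ Ici x₂, f u = a → f v = a → f w = a →
      {x | 0 < x ∧ f x = a} = {u, v, w} := by
    intro u hu v hv w hw hua hva hwa
    ext x
    simp only [mem_ofPred_eq, mem_insert_iff, mem_singleton_iff]
    constructor
    · rintro ⟨hx, hxa⟩
      rcases le_total x x₁ with hx₁ | hx₁
      · exact Or.inl (hl.injOn ⟨hx, hx₁⟩ hu (hxa.trans hua.symm))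
      rcases le_total x x₂ with hx₂ | hx₂
      · exact Or.inr (Or.inl (hm.injOn ⟨hx₁, hx₂⟩ hv (hxa.trans hva.symm)))
      · exact Or.inr (Or.inr (hr.injOn hx₂ hw (hxa.trans hwa.symm)))
    · rintro (rfl | rfl | rfl)
      · exact ⟨hu.1, hua⟩
      · exact ⟨h₁.trans_le hv.1, hva⟩
      · exact ⟨(h₁.trans h₁₂).trans_le hw, hwa⟩
  refine ⟨fun ha₁ ha₂ ↦ ?_, ?_⟩
  · obtain ⟨u, hu, hua⟩ := hleft ha₁.le
    obtain ⟨v, hv, hva⟩ := hmid ha₁.le ha₂.le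
    obtain ⟨w, hw, hwa⟩ := hright ha₂.le
    have hux : u ≠ x₁ := by rintro rfl; exact ha₁.ne hua
    have hwx : w ≠ x₂ := by rintro rfl; exact ha₂.ne' hwa
    have huv : u < v := (hu.2.lt_of_ne hux).trans_le hv.1
    have hvw : v < w := hv.2.trans_lt (lt_of_le_of_ne hw hwx.symm)
    rw [hset u hu v hv w hw hua hva hwa]
    exact ncard_eq_three.2 ⟨u, v, w, huv.ne, (huv.trans hvw).ne, hvw.ne, rfl⟩
  · rintro (rfl | rfl)
    · obtain ⟨w, hw, hwa⟩ := hright hf.le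
      rw [hset x₁ ⟨h₁, le_rfl⟩ x₁ ⟨le_rfl, h₁₂.le⟩ w hw rfl rfl hwa, insert_eq_of_mem (by simp)]
      exact ncard_pair (h₁₂.trans_le hw).ne
    · obtain ⟨u, hu, hua⟩ := hleft hf.le
      rw [hset u hu x₂ ⟨h₁₂.le, le_rfl⟩ x₂ self_mem_Ici hua rfl rfl, pair_eq_singleton]
      exact ncard_pair (hu.2.trans_lt h₁₂).ne

lemma hasDerivAt_sosRatio {k : ℕ} (hk : k ≠ 0) {b x : ℝ} (hb : 0 < b) (hx : 0 < x) :
    HasDerivAt (sosRatio k b)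
      (-(((1 + x) / (b + x)) ^ (k - 1) / (x ^ 2 * (b + x) ^ 2) *
        (x ^ 2 + (2 - (b - 1) * ((k : ℝ) - 1)) * x + b))) x := by
  have hbx : b + x ≠ 0 := by positivity
  have ht : HasDerivAt (fun x : ℝ ↦ (1 + x) / (b + x)) _ x :=
    ((hasDerivAt_id x).const_add 1).div ((hasDerivAt_id x).const_add b) hbx
  have hi : HasDerivAt (fun x : ℝ ↦ 1 / x) _ x :=
    (hasDerivAt_const x (1 : ℝ)).div (hasDerivAt_id x) hx.ne'
  refine (hi.mul (ht.pow k)).congr_deriv ?_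
  obtain ⟨n, rfl⟩ := Nat.exists_eq_succ_of_ne_zero hk
  simp only [Nat.succ_eq_add_one, Nat.add_sub_cancel, pow_succ _ n, id, Nat.cast_add, Nat.cast_one,
    Pi.pow_apply]
  generalize ((1 + x) / (b + x)) ^ n = p
  field_simp
  ring

lemma le_sosRatio {k : ℕ} {b x : ℝ} (hb : 1 ≤ b) (hx : 0 < x) :
    (1 / x) * (1 / b) ^ k ≤ sosRatio k b x := by
  have h : 1 / b ≤ (1 + x) / (b + x) := by
    rw [div_le_div_iff₀ (by positivity) (by positivity)]
    nlinarith
  unfold sosRatio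
  gcongr

lemma sosRatio_le {k : ℕ} {b x : ℝ} (hb : 1 ≤ b) (hx : 0 < x) : sosRatio k b x ≤ 1 / x := by
  have h : (1 + x) / (b + x) ≤ 1 := by
    rw [div_le_one (by positivity)]
    linarith
  exact mul_le_of_le_one_right (by positivity) (pow_le_one₀ (by positivity) h)

lemma exists_le_sosRatio {k : ℕ} {b c a : ℝ} (hb : 1 ≤ b) (hc : 0 < c) (ha : 0 < a) :
    ∃ y ∈ Ioc 0 c, a ≤ sosRatio k b y := by
  have hy : 0 < min c ((1 / b) ^ k / a) := by positivity
  refine ⟨_, ⟨hy, min_le_left _ _⟩, le_trans ?_ (le_sosRatio hb hy)⟩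
  rw [one_div_mul_eq_div, le_div_iff₀ hy, mul_comm, ← le_div_iff₀ ha]
  exact min_le_right _ _

lemma exists_sosRatio_le {k : ℕ} {b c a : ℝ} (hb : 1 ≤ b) (hc : 0 < c) (ha : 0 < a) :
    ∃ z ∈ Ici c, sosRatio k b z ≤ a := by
  have hz : 0 < max c (1 / a) := lt_max_of_lt_left hc
  refine ⟨_, le_max_left c (1 / a), (sosRatio_le hb hz).trans ?_⟩
  rw [one_div_le hz ha]
  exact le_max_right _ _

lemma exists_pos_roots_of_two_mul_sqrt_lt {p c : ℝ} (hc : 0 < c) (hp : 2 * √c < p) :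
    ∃ x₁ x₂ : ℝ, 0 < x₁ ∧ x₁ < x₂ ∧ ∀ x, x ^ 2 - p * x + c = (x - x₁) * (x - x₂) := by
  have hs := Real.sq_sqrt hc.le
  have hs0 := Real.sqrt_pos.2 hc
  have hD : 0 < p ^ 2 - 4 * c := by nlinarith
  have hr := Real.sq_sqrt hD.le
  have hr0 := Real.sqrt_pos.2 hD
  have hrp : √(p ^ 2 - 4 * c) < p := by
    rw [Real.sqrt_lt' (by linarith)]
    linarith
  refine ⟨(p - √(p ^ 2 - 4 * c)) / 2, (p + √(p ^ 2 - 4 * c)) / 2, by linarith, by linarith,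
    fun x ↦ ?_⟩
  linear_combination (1 / 4) * hr

lemma two_mul_sqrt_lt_of_sq_lt {k b : ℝ} (hk : 1 < k) (hb : ((k + 1) / (k - 1)) ^ 2 < b) :
    2 * √b < (b - 1) * (k - 1) - 2 := by
  have hk' : 0 < k - 1 := sub_pos.2 hk
  have hs := Real.sq_sqrt ((sq_nonneg _).trans hb.le)
  have h := Real.lt_sqrt_of_sq_lt hb
  rw [div_lt_iff₀ hk'] at h
  nlinarith [Real.sqrt_nonneg b]


/-- For k ≥ 2 and b > ((k+1)/(k-1))², the quadratic x² + (2-(b-1)(k-1))x + b = 0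
has two distinct positive roots x₁ < x₂; with νᵢ = (1/xᵢ)·((1+xᵢ)/(b+xᵢ))^k,
ν_min = min ν₁ ν₂, ν_max = max ν₁ ν₂, one has 0 < ν_min < ν_max, and for a > 0
the equation a·x = ((1+x)/(b+x))^k has exactly three solutions x ≥ 0 if
ν_min < a < ν_max and exactly two if a = ν_min or a = ν_max. -/
theorem sos_solution_count_large_b (k : ℕ) (hk : 2 ≤ k) (b : ℝ)
    (hb : (((k : ℝ) + 1) / ((k : ℝ) - 1)) ^ 2 < b) :
    ∃ x₁ x₂ : ℝ, 0 < x₁ ∧ x₁ < x₂ ∧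
      (∀ x : ℝ, x ^ 2 + (2 - (b - 1) * ((k : ℝ) - 1)) * x + b = 0 ↔ x = x₁ ∨ x = x₂) ∧
      (0 < min ((1 / x₁) * ((1 + x₁) / (b + x₁)) ^ k) ((1 / x₂) * ((1 + x₂) / (b + x₂)) ^ k) ∧
       min ((1 / x₁) * ((1 + x₁) / (b + x₁)) ^ k) ((1 / x₂) * ((1 + x₂) / (b + x₂)) ^ k)
         < max ((1 / x₁) * ((1 + x₁) / (b + x₁)) ^ k) ((1 / x₂) * ((1 + x₂) / (b + x₂)) ^ k)) ∧
      (∀ a : ℝ, 0 < a →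
        ((min ((1 / x₁) * ((1 + x₁) / (b + x₁)) ^ k) ((1 / x₂) * ((1 + x₂) / (b + x₂)) ^ k) < a ∧
          a < max ((1 / x₁) * ((1 + x₁) / (b + x₁)) ^ k) ((1 / x₂) * ((1 + x₂) / (b + x₂)) ^ k)) →
          {x : ℝ | 0 ≤ x ∧ a * x = ((1 + x) / (b + x)) ^ k}.ncard = 3) ∧
        ((a = min ((1 / x₁) * ((1 + x₁) / (b + x₁)) ^ k) ((1 / x₂) * ((1 + x₂) / (b + x₂)) ^ k) ∨
          a = max ((1 / x₁) * ((1 + x₁) / (b + x₁)) ^ k) ((1 / x₂) * ((1 + x₂) / (b + x₂)) ^ k)) →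
          {x : ℝ | 0 ≤ x ∧ a * x = ((1 + x) / (b + x)) ^ k}.ncard = 2)) := by
  have hk1 : (1 : ℝ) < k := by exact_mod_cast hk
  have hb1 : 1 < b := by
    refine lt_trans (one_lt_pow₀ ?_ two_ne_zero) hb
    rw [one_lt_div (by linarith)]
    linarith
  have hb0 : 0 < b := by linarith
  obtain ⟨x₁, x₂, h₁, h₁₂, hfac⟩ :=
    exists_pos_roots_of_two_mul_sqrt_lt hb0 (two_mul_sqrt_lt_of_sq_lt hk1 hb)
  have hq : ∀ x : ℝ, x ^ 2 + (2 - (b - 1) * ((k : ℝ) - 1)) * x + b = (x - x₁) * (x - x₂) :=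
    fun x ↦ by rw [← hfac]; ring
  have hder : ∀ x, 0 < x → HasDerivAt (sosRatio k b)
      (-(((1 + x) / (b + x)) ^ (k - 1) / (x ^ 2 * (b + x) ^ 2) * ((x - x₁) * (x - x₂)))) x :=
    fun x hx ↦ by rw [← hq]; exact hasDerivAt_sosRatio (by lia) hb0 hx
  have hcoef : ∀ x, 0 < x → 0 < ((1 + x) / (b + x)) ^ (k - 1) / (x ^ 2 * (b + x) ^ 2) :=
    fun x hx ↦ by positivity
  have hc : ContinuousOn (sosRatio k b) (Ioi 0) :=
    fun x hx ↦ (hder x hx).continuousAt.continuousWithinAt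
  have hl : StrictAntiOn (sosRatio k b) (Ioc 0 x₁) := by
    refine strictAntiOn_of_deriv_neg (convex_Ioc _ _) (hc.mono fun x hx ↦ hx.1) fun x hx ↦ ?_
    rw [interior_Ioc] at hx
    rw [(hder x hx.1).deriv, neg_lt_zero]
    exact mul_pos (hcoef x hx.1) (mul_pos_of_neg_of_neg (by linarith [hx.2]) (by linarith [hx.2]))
  have hm : StrictMonoOn (sosRatio k b) (Icc x₁ x₂) := by
    refine strictMonoOn_of_deriv_pos (convex_Icc _ _) (hc.mono fun x hx ↦ h₁.trans_le hx.1)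
      fun x hx ↦ ?_
    rw [interior_Icc] at hx
    have hx0 := h₁.trans hx.1
    rw [(hder x hx0).deriv, neg_pos]
    exact mul_neg_of_pos_of_neg (hcoef x hx0)
      (mul_neg_of_pos_of_neg (sub_pos.2 hx.1) (sub_neg.2 hx.2))
  have hr : StrictAntiOn (sosRatio k b) (Ici x₂) := by
    refine strictAntiOn_of_deriv_neg (convex_Ici _)
      (hc.mono fun x hx ↦ (h₁.trans h₁₂).trans_le hx) fun x hx ↦ ?_
    rw [interior_Ici, mem_Ioi] at hx
    have hx0 := (h₁.trans h₁₂).trans hx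
    rw [(hder x hx0).deriv, neg_lt_zero]
    exact mul_pos (hcoef x hx0) (mul_pos (by linarith) (by linarith))
  have hlt : sosRatio k b x₁ < sosRatio k b x₂ := hm ⟨le_rfl, h₁₂.le⟩ ⟨h₁₂.le, le_rfl⟩ h₁₂
  refine ⟨x₁, x₂, h₁, h₁₂, fun x ↦ by rw [hq, mul_eq_zero, sub_eq_zero, sub_eq_zero], ?_⟩
  simp only [← sosRatio.eq_def]
  rw [min_eq_left hlt.le, max_eq_right hlt.le]
  refine ⟨⟨by unfold sosRatio; positivity, hlt⟩, fun a ha ↦ ?_⟩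
  have hset : {x : ℝ | 0 ≤ x ∧ a * x = ((1 + x) / (b + x)) ^ k} =
      {x | 0 < x ∧ sosRatio k b x = a} := by
    ext x
    have hiff : 0 < x → (sosRatio k b x = a ↔ a * x = ((1 + x) / (b + x)) ^ k) := fun hx ↦ by
      rw [sosRatio, one_div_mul_eq_div, div_eq_iff hx.ne', eq_comm]
    constructor
    · rintro ⟨hx, hxa⟩
      have hx0 : 0 < x := pos_of_mul_pos_right (hxa ▸ by positivity) ha.le
      exact ⟨hx0, (hiff hx0).2 hxa⟩
    · rintro ⟨hx, hxa⟩
      exact ⟨hx.le, (hiff hx).1 hxa⟩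
  rw [hset]
  have hcount := ncard_level_set_of_anti_mono_anti h₁ h₁₂ hc hl hm hr
    (exists_le_sosRatio hb1.le h₁ ha) (exists_sosRatio_le hb1.le (h₁.trans h₁₂) ha)
  exact ⟨fun h ↦ hcount.1 h.1 h.2, hcount.2⟩
end

section
/- Let θ, z₀, z₁ be real numbers and let k ≥ 1 be an integer. Set A = z₀ + θ·z₁ + θ² and B = θ²·z₀ + θ·z₁ + 1. Then z₀·B^k − A^k = (z₀ − 1)·( B^k + (θ² − 1)·∑_{i=0}^{k−1} A^i · B^{k−1−i} ). -/
/-- The factorization identity (3.6): with A = z₀ + θz₁ + θ² and B = θ²z₀ + θz₁ + 1,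
z₀·B^k − A^k = (z₀ − 1)·(B^k + (θ² − 1)·∑_{i=0}^{k-1} A^i·B^(k-1-i)). -/
theorem sos_factorization_identity (θ z₀ z₁ : ℝ) (k : ℕ) (hk : 1 ≤ k) :
    z₀ * (θ ^ 2 * z₀ + θ * z₁ + 1) ^ k - (z₀ + θ * z₁ + θ ^ 2) ^ k =
      (z₀ - 1) * ((θ ^ 2 * z₀ + θ * z₁ + 1) ^ k +
        (θ ^ 2 - 1) * ∑ i ∈ Finset.range k,
          (z₀ + θ * z₁ + θ ^ 2) ^ i * (θ ^ 2 * z₀ + θ * z₁ + 1) ^ (k - 1 - i)) := by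
  linear_combination
    (Commute.all (z₀ + θ * z₁ + θ ^ 2) (θ ^ 2 * z₀ + θ * z₁ + 1)).geom_sum₂_mul k
end

section
/- Let k ≥ 1 be an integer and let θ ≥ 1 be a real number. Then the system of equations z₀ = ((z₀ + θz₁ + θ²)/(θ²z₀ + θz₁ + 1))^k, z₁ = ((θz₀ + z₁ + θ)/(θ²z₀ + θz₁ + 1))^k has exactly one solution with z₀ > 0 and z₁ > 0; moreover this solution satisfies z₀ = 1. -/
/-- A positive solution of the first equation equals `1`, because the ratio on its right-hand side
is at most `1` when `1 ≤ z₀` and at least `1` when `z₀ ≤ 1`. -/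
lemma sos_fst_eq_one {k : ℕ} {θ z₀ z₁ : ℝ} (hθ : 1 ≤ θ) (h₀ : 0 < z₀) (h₁ : 0 < z₁)
    (h : z₀ = ((z₀ + θ * z₁ + θ ^ 2) / (θ ^ 2 * z₀ + θ * z₁ + 1)) ^ k) : z₀ = 1 := by
  have hsq : 1 ≤ θ ^ 2 := one_le_pow₀ hθ
  rcases le_total z₀ 1 with hz | hz
  · refine le_antisymm hz ?_
    rw [h]
    refine one_le_pow₀ ((one_le_div (by positivity)).2 ?_)
    nlinarith
  · refine le_antisymm ?_ hz
    rw [h]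
    refine pow_le_one₀ (by positivity) ((div_le_one (by positivity)).2 ?_)
    nlinarith

/-- On the line `z₀ = 1` the right-hand side of the second equation is antitone in `z₁`. -/
lemma sos_snd_antitone (k : ℕ) {θ a b : ℝ} (hθ : 1 ≤ θ) (ha : 0 ≤ a) (hab : a ≤ b) :
    ((θ * 1 + b + θ) / (θ ^ 2 * 1 + θ * b + 1)) ^ k ≤
      ((θ * 1 + a + θ) / (θ ^ 2 * 1 + θ * a + 1)) ^ k := by
  have hb : 0 ≤ b := ha.trans hab
  refine pow_le_pow_left₀ (by positivity) ?_ k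
  rw [div_le_div_iff₀ (by positivity) (by positivity)]
  have hsq : 1 ≤ θ ^ 2 := one_le_pow₀ hθ
  nlinarith [mul_nonneg (sub_nonneg.2 hsq) (sub_nonneg.2 hab)]

/-- On the line `z₀ = 1` the second equation has a positive solution. -/
lemma sos_snd_exists (k : ℕ) {θ : ℝ} (hθ : 1 ≤ θ) :
    ∃ z : ℝ, 0 < z ∧ z = ((θ * 1 + z + θ) / (θ ^ 2 * 1 + θ * z + 1)) ^ k := by
  have hcont : ContinuousOn
      (fun z : ℝ => ((θ * 1 + z + θ) / (θ ^ 2 * 1 + θ * z + 1)) ^ k) (Set.Icc 0 1) := by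
    refine ContinuousOn.pow (ContinuousOn.div (by fun_prop) (by fun_prop) ?_) k
    rintro z ⟨hz, -⟩
    positivity
  have hone : ((θ * 1 + 1 + θ) / (θ ^ 2 * 1 + θ * 1 + 1)) ^ k ≤ 1 := by
    refine pow_le_one₀ (by positivity) ((div_le_one (by positivity)).2 ?_)
    nlinarith
  obtain ⟨z, ⟨hz, -⟩, h⟩ := isPreconnected_Icc.intermediate_value₂
    (Set.left_mem_Icc.2 zero_le_one) (Set.right_mem_Icc.2 zero_le_one) continuousOn_id hcont
    (by simp only [id]; positivity) hone
  refine ⟨z, ?_, h⟩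
  rw [show z = _ from h]
  positivity

/-- For θ ≥ 1 the translation-invariant system has exactly one positive solution,
and this solution has z₀ = 1. -/
theorem sos_unique_TI_solution_AFM (k : ℕ) (hk : 1 ≤ k) (θ : ℝ) (hθ : 1 ≤ θ) :
    (∃! p : ℝ × ℝ, 0 < p.1 ∧ 0 < p.2 ∧
      p.1 = ((p.1 + θ * p.2 + θ ^ 2) / (θ ^ 2 * p.1 + θ * p.2 + 1)) ^ k ∧
      p.2 = ((θ * p.1 + p.2 + θ) / (θ ^ 2 * p.1 + θ * p.2 + 1)) ^ k) ∧
    (∀ z₀ z₁ : ℝ, 0 < z₀ → 0 < z₁ →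
      z₀ = ((z₀ + θ * z₁ + θ ^ 2) / (θ ^ 2 * z₀ + θ * z₁ + 1)) ^ k →
      z₁ = ((θ * z₀ + z₁ + θ) / (θ ^ 2 * z₀ + θ * z₁ + 1)) ^ k →
      z₀ = 1) := by
  refine ⟨?_, fun z₀ z₁ h₀ h₁ h _ => sos_fst_eq_one hθ h₀ h₁ h⟩
  obtain ⟨z, hz, h⟩ := sos_snd_exists k hθ
  refine ⟨(1, z), ⟨one_pos, hz, ?_, h⟩, ?_⟩
  · have hne : θ ^ 2 * 1 + θ * z + 1 ≠ 0 := by positivity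
    rw [show 1 + θ * z + θ ^ 2 = θ ^ 2 * 1 + θ * z + 1 by ring, div_self hne, one_pow]
  · rintro ⟨w₀, w⟩ ⟨hw₀, hw, e₀, e⟩
    obtain rfl : w₀ = 1 := sos_fst_eq_one hθ hw₀ hw e₀
    have e' : w = ((θ * 1 + w + θ) / (θ ^ 2 * 1 + θ * w + 1)) ^ k := e
    refine Prod.ext rfl ?_
    rcases le_total w z with hwz | hwz
    · exact le_antisymm hwz (h.trans_le ((sos_snd_antitone k hθ hw.le hwz).trans_eq e'.symm))
    · exact le_antisymm (e'.trans_le ((sos_snd_antitone k hθ hz.le hwz).trans_eq h.symm)) hwz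
end

section
/- Let k ≥ 2 be an integer and 0 < θ < 1 a real number with θ² < (k−1)²/(k²+6k+1). Let z₋* and z₊* be respectively the smallest and the largest positive fixed point of ψ(x) = ((2θ + x)/(1 + θ² + θx))^k. Let V be any set, S : V → (Fin k → V) any map assigning to each element k successors, and z : V → ℝ any function with z(x) > 0 for all x satisfying the recursion z(x) = ∏_{i=1}^{k} (2θ + z(S(x)(i)))/(1 + θ² + θ·z(S(x)(i))) for every x ∈ V. Then z₋* ≤ z(x) ≤ z₊* for every x ∈ V. -/
open Set Function in
/-- A solution of a multiplicative recursion with a monotone continuous bounded factor `f`, positive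
on `[0, ∞)`, is bounded by positive fixed points of `f ^ k`. -/
theorem exists_fixedPoint_bounds {k : ℕ} {f : ℝ → ℝ} {C : ℝ}
    (hcont : ContinuousOn f (Ici 0)) (hmono : MonotoneOn f (Ici 0)) (hf0 : 0 < f 0)
    (hC : ∀ x, 0 ≤ x → f x ≤ C) {V : Type*} {S : V → Fin k → V} {z : V → ℝ}
    (hpos : ∀ x, 0 < z x) (hrec : ∀ x, z x = ∏ i, f (z (S x i))) (x : V) :
    ∃ a b : ℝ, (0 < a ∧ f a ^ k = a) ∧ (0 < b ∧ f b ^ k = b) ∧ a ≤ z x ∧ z x ≤ b := by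
  have : Nonempty V := ⟨x⟩
  have hfpos : ∀ y, 0 ≤ y → 0 < f y := fun y hy =>
    hf0.trans_le (hmono self_mem_Ici hy hy)
  have hC0 : 0 < C := hf0.trans_le (hC 0 le_rfl)
  have hbelow : BddBelow (range z) := ⟨0, by rintro _ ⟨y, rfl⟩; exact (hpos y).le⟩
  have habove : BddAbove (range z) := by
    refine ⟨C ^ k, ?_⟩
    rintro _ ⟨y, rfl⟩
    rw [hrec y]
    calc ∏ i, f (z (S y i)) ≤ ∏ _i : Fin k, C :=
          Finset.prod_le_prod (fun i _ => (hfpos _ (hpos _).le).le) fun i _ => hC _ (hpos _).le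
      _ = C ^ k := by simp
  have hinf0 : 0 ≤ ⨅ y, z y := le_ciInf fun y => (hpos y).le
  have hsup0 : 0 ≤ ⨆ y, z y := (hpos x).le.trans (le_ciSup habove x)
  have hinf : f (⨅ y, z y) ^ k ≤ ⨅ y, z y := by
    refine le_ciInf fun y => ?_
    calc f (⨅ y, z y) ^ k = ∏ _i : Fin k, f (⨅ y, z y) := by simp
      _ ≤ ∏ i, f (z (S y i)) :=
          Finset.prod_le_prod (fun i _ => (hfpos _ hinf0).le) fun i _ =>
            hmono hinf0 (hpos _).le (ciInf_le hbelow _)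
      _ = z y := (hrec y).symm
  have hsup : (⨆ y, z y) ≤ f (⨆ y, z y) ^ k := by
    refine ciSup_le fun y => ?_
    calc z y = ∏ i, f (z (S y i)) := hrec y
      _ ≤ ∏ _i : Fin k, f (⨆ y, z y) :=
          Finset.prod_le_prod (fun i _ => (hfpos _ (hpos _).le).le) fun i _ =>
            hmono (hpos _).le hsup0 (le_ciSup habove _)
      _ = f (⨆ y, z y) ^ k := by simp
  have hpow : ∀ y, 0 ≤ y → f y ^ k ≤ C ^ k := fun y hy =>
    pow_le_pow_left₀ (hfpos y hy).le (hC y hy) k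
  have hcontk : ContinuousOn (fun y => f y ^ k) (Ici 0) := hcont.pow k
  obtain ⟨a, ha, hfa⟩ := exists_mem_Icc_isFixedPt
    (hcontk.mono Icc_subset_Ici_self) hinf0 (pow_pos hf0 k).le hinf
  obtain ⟨b, hb, hfb⟩ := exists_mem_Icc_isFixedPt
    (hcontk.mono fun y hy => hsup0.trans hy.1) (hsup.trans (hpow _ hsup0)) hsup
    (hpow _ (pow_pos hC0 k).le)
  have hxb : z x ≤ b := (le_ciSup habove x).trans hb.1
  exact ⟨a, b, ⟨(pow_pos (hfpos a ha.1) k).trans_eq hfa, hfa⟩, ⟨(hpos x).trans_le hxb, hfb⟩,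
    ha.2.trans (ciInf_le hbelow x), hxb⟩

/-- Below the critical temperature (θ² < (k-1)²/(k²+6k+1)), any positive solution of
the splitting recursion on a k-ary successor structure lies between the smallest and
largest positive fixed points of ψ(x) = ((2θ+x)/(1+θ²+θx))^k. -/
theorem sos_solution_bounds (k : ℕ) (hk : 2 ≤ k) (θ : ℝ)
    (hθ0 : 0 < θ) (hθ1 : θ < 1)
    (hcr : θ ^ 2 < ((k : ℝ) - 1) ^ 2 / ((k : ℝ) ^ 2 + 6 * k + 1))
    (zm zp : ℝ)
    (hzm : IsLeast {z : ℝ | 0 < z ∧ ((2 * θ + z) / (1 + θ ^ 2 + θ * z)) ^ k = z} zm)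
    (hzp : IsGreatest {z : ℝ | 0 < z ∧ ((2 * θ + z) / (1 + θ ^ 2 + θ * z)) ^ k = z} zp)
    (V : Type*) (S : V → Fin k → V) (z : V → ℝ)
    (hpos : ∀ x, 0 < z x)
    (hrec : ∀ x, z x = ∏ i : Fin k, (2 * θ + z (S x i)) / (1 + θ ^ 2 + θ * z (S x i))) :
    ∀ x, zm ≤ z x ∧ z x ≤ zp := by
  intro x
  have hden : ∀ y : ℝ, 0 ≤ y → 0 < 1 + θ ^ 2 + θ * y := fun y hy => by positivity
  have hθsq : θ ^ 2 < 1 := pow_lt_one₀ hθ0.le hθ1 two_ne_zero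
  obtain ⟨a, b, ha, hb, hax, hxb⟩ := exists_fixedPoint_bounds
    (f := fun y => (2 * θ + y) / (1 + θ ^ 2 + θ * y)) (C := 1 / θ)
    (ContinuousOn.div (by fun_prop) (by fun_prop) fun y hy => (hden y hy).ne')
    (fun y hy w hw hyw => by
      rw [div_le_div_iff₀ (hden y hy) (hden w hw)]
      nlinarith [mul_nonneg (sub_nonneg.2 hyw) (sub_nonneg.2 hθsq.le)])
    (by positivity)
    (fun y hy => by
      rw [div_le_div_iff₀ (hden y hy) hθ0]
      nlinarith)
    hpos hrec x
  exact ⟨(hzm.2 ha).trans hax, hxb.trans (hzp.2 hb)⟩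
end

section
/- Let k ≥ 2 be an integer and 0 < θ < 1 a real number with θ² ≥ (k−1)²/(k²+6k+1), and let z* be the unique positive fixed point of ψ(x) = ((2θ + x)/(1 + θ² + θx))^k. Let V be any set, S : V → (Fin k → V) any map assigning to each element k successors, and z : V → ℝ any function with z(x) > 0 for all x satisfying the recursion z(x) = ∏_{i=1}^{k} (2θ + z(S(x)(i)))/(1 + θ² + θ·z(S(x)(i))) for every x ∈ V. Then z(x) = z* for every x ∈ V. -/
section FixedPoint

open Set

/-- The single-successor factor of the recursion is monotone on `[0, ∞)`. -/
lemma sos_factor_le {θ : ℝ} (hθ0 : 0 < θ) (hθ1 : θ < 1) {x y : ℝ} (hx : 0 ≤ x) (hxy : x ≤ y) :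
    (2 * θ + x) / (1 + θ ^ 2 + θ * x) ≤ (2 * θ + y) / (1 + θ ^ 2 + θ * y) := by
  have hy : 0 ≤ y := hx.trans hxy
  rw [div_le_div_iff₀ (by positivity) (by positivity)]
  have hθ : 0 ≤ 1 - θ ^ 2 := by nlinarith
  nlinarith [mul_nonneg hθ (sub_nonneg.2 hxy)]

lemma sos_factor_le_inv {θ : ℝ} (hθ0 : 0 < θ) (hθ1 : θ < 1) {x : ℝ} (hx : 0 ≤ x) :
    (2 * θ + x) / (1 + θ ^ 2 + θ * x) ≤ 1 / θ := by
  rw [div_le_div_iff₀ (by positivity) hθ0]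
  nlinarith

lemma continuousOn_sos_factor_pow {θ : ℝ} (hθ0 : 0 < θ) (k : ℕ) :
    ContinuousOn (fun x : ℝ => ((2 * θ + x) / (1 + θ ^ 2 + θ * x)) ^ k) (Ici 0) := by
  refine ContinuousOn.pow (ContinuousOn.div (by fun_prop) (by fun_prop) fun x hx => ?_) k
  have hx : 0 ≤ x := hx
  positivity

/-- A continuous self-map has a fixed point in an interval whose ends it moves inwards. -/
lemma exists_fixedPoint_mem_Icc {f : ℝ → ℝ} {a b : ℝ} (hab : a ≤ b)
    (hf : ContinuousOn f (Icc a b)) (ha : a ≤ f a) (hb : f b ≤ b) :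
    ∃ w ∈ Icc a b, f w = w := by
  obtain ⟨w, hw, h⟩ := intermediate_value_Icc hab (continuousOn_id.sub hf)
    (show (0 : ℝ) ∈ Icc (a - f a) (b - f b) from ⟨sub_nonpos.2 ha, sub_nonneg.2 hb⟩)
  exact ⟨w, hw, (sub_eq_zero.1 h).symm⟩

end FixedPoint

/-- At or above the critical temperature (θ² ≥ (k-1)²/(k²+6k+1)), any positive
solution of the splitting recursion on a k-ary successor structure equals the unique
positive fixed point of ψ(x) = ((2θ+x)/(1+θ²+θx))^k. -/
theorem sos_solution_unique_high_temp (k : ℕ) (hk : 2 ≤ k) (θ : ℝ)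
    (hθ0 : 0 < θ) (hθ1 : θ < 1)
    (hcr : ((k : ℝ) - 1) ^ 2 / ((k : ℝ) ^ 2 + 6 * k + 1) ≤ θ ^ 2)
    (zstar : ℝ)
    (hstar : 0 < zstar ∧ ((2 * θ + zstar) / (1 + θ ^ 2 + θ * zstar)) ^ k = zstar)
    (huniq : ∀ w : ℝ, 0 < w → ((2 * θ + w) / (1 + θ ^ 2 + θ * w)) ^ k = w → w = zstar)
    (V : Type*) (S : V → Fin k → V) (z : V → ℝ)
    (hpos : ∀ x, 0 < z x)
    (hrec : ∀ x, z x = ∏ i : Fin k, (2 * θ + z (S x i)) / (1 + θ ^ 2 + θ * z (S x i))) :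
    ∀ x, z x = zstar := by
  intro x₀
  have : Nonempty V := ⟨x₀⟩
  set f : ℝ → ℝ := fun x => ((2 * θ + x) / (1 + θ ^ 2 + θ * x)) ^ k with hf
  have hcont : ContinuousOn f (Set.Ici 0) := continuousOn_sos_factor_pow hθ0 k
  have factor_nonneg : ∀ x : ℝ, 0 ≤ x → 0 ≤ (2 * θ + x) / (1 + θ ^ 2 + θ * x) := by
    intro x hx
    positivity
  have f_le : ∀ x : ℝ, 0 ≤ x → f x ≤ (1 / θ) ^ k := fun x hx =>
    pow_le_pow_left₀ (factor_nonneg x hx) (sos_factor_le_inv hθ0 hθ1 hx) k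
  have le_f : ∀ b, (∀ y, z y ≤ b) → ∀ x, z x ≤ f b := by
    intro b hb x
    rw [hrec x]
    calc _ ≤ ∏ _i : Fin k, (2 * θ + b) / (1 + θ ^ 2 + θ * b) :=
          Finset.prod_le_prod (fun i _ => factor_nonneg _ (hpos _).le)
            fun i _ => sos_factor_le hθ0 hθ1 (hpos _).le (hb _)
      _ = f b := by
          simp only [hf, Finset.prod_const, Finset.card_univ, Fintype.card_fin]
  have f_le_of_le : ∀ a, 0 ≤ a → (∀ y, a ≤ z y) → ∀ x, f a ≤ z x := by
    intro a ha hb x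
    rw [hrec x]
    calc f a = ∏ _i : Fin k, (2 * θ + a) / (1 + θ ^ 2 + θ * a) := by
          simp only [hf, Finset.prod_const, Finset.card_univ, Fintype.card_fin]
      _ ≤ _ := Finset.prod_le_prod (fun i _ => factor_nonneg _ ha)
            fun i _ => sos_factor_le hθ0 hθ1 ha (hb _)
  have hf0 : 0 < f 0 := by
    simp only [hf]
    positivity
  have hbelow : BddBelow (Set.range z) :=
    ⟨0, by rintro _ ⟨x, rfl⟩; exact (hpos x).le⟩
  have habove : BddAbove (Set.range z) := by
    refine ⟨(1 / θ) ^ k, ?_⟩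
    rintro _ ⟨x, rfl⟩
    rw [hrec x]
    calc _ ≤ ∏ _i : Fin k, 1 / θ :=
          Finset.prod_le_prod (fun i _ => factor_nonneg _ (hpos _).le)
            fun i _ => sos_factor_le_inv hθ0 hθ1 (hpos _).le
      _ = (1 / θ) ^ k := by simp
  have hinf : 0 < ⨅ x, z x :=
    hf0.trans_le (le_ciInf (f_le_of_le 0 le_rfl fun y => (hpos y).le))
  have hsup : 0 < ⨆ x, z x := (hpos x₀).trans_le (le_ciSup habove x₀)
  apply le_antisymm
  · obtain ⟨w, hw, hfw⟩ := exists_fixedPoint_mem_Icc (f := f)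
      (le_max_left (⨆ x, z x) ((1 / θ) ^ k))
      (hcont.mono fun y hy => hsup.le.trans hy.1)
      (ciSup_le (le_f _ fun y => le_ciSup habove y))
      ((f_le _ (hsup.le.trans (le_max_left _ _))).trans (le_max_right _ _))
    exact (le_ciSup habove x₀).trans (hw.1.trans (huniq w (hsup.trans_le hw.1) hfw).le)
  · obtain ⟨w, hw, hfw⟩ := exists_fixedPoint_mem_Icc (f := f) hinf.le
      (hcont.mono fun y hy => hy.1) hf0.le
      (le_ciInf (f_le_of_le _ hinf.le fun y => ciInf_le hbelow y))
    have hw0 : 0 < w := hw.1.lt_of_ne fun h => by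
      rw [← h] at hfw
      exact hf0.ne' hfw
    exact (huniq w hw0 hfw).ge.trans (hw.2.trans (ciInf_le hbelow x₀))
end

section
/- Let θ > 0 be a real number with θ ≠ 1. Then the map F = (F₀, F₁) : ℝ² → ℝ² given by F₀(h₀,h₁) = log((e^{h₀} + θe^{h₁} + θ²)/(θ²e^{h₀} + θe^{h₁} + 1)) and F₁(h₀,h₁) = log((θe^{h₀} + e^{h₁} + θ)/(θ²e^{h₀} + θe^{h₁} + 1)) is injective; that is, F(h) = F(l) if and only if h = l. -/
/-- The matrix `(θ ^ |i - j|)` of size three has trivial kernel when `θ ^ 2 ≠ 1`. -/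
theorem sos_kernel_trivial {θ a b c : ℝ} (hθ : 1 - θ ^ 2 ≠ 0)
    (h₀ : a + θ * b + θ ^ 2 * c = 0) (h₁ : θ * a + b + θ * c = 0)
    (h₂ : θ ^ 2 * a + θ * b + c = 0) : a = 0 ∧ b = 0 ∧ c = 0 := by
  have ha : a = 0 := (mul_eq_zero.mp (by linear_combination h₀ - θ * h₁ :
    (1 - θ ^ 2) * a = 0)).resolve_left hθ
  have hc : c = 0 := (mul_eq_zero.mp (by linear_combination h₂ - θ * h₁ :
    (1 - θ ^ 2) * c = 0)).resolve_left hθ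
  subst ha hc
  exact ⟨rfl, by linarith, rfl⟩

/-- For θ > 0, θ ≠ 1, the recursion map F = (F₀,F₁) is injective. -/
theorem sos_F_injective (θ : ℝ) (hθ : 0 < θ) (hθ1 : θ ≠ 1) :
    Function.Injective (fun h : ℝ × ℝ =>
      ((Real.log ((Real.exp h.1 + θ * Real.exp h.2 + θ ^ 2) /
          (θ ^ 2 * Real.exp h.1 + θ * Real.exp h.2 + 1)),
        Real.log ((θ * Real.exp h.1 + Real.exp h.2 + θ) /
          (θ ^ 2 * Real.exp h.1 + θ * Real.exp h.2 + 1))) : ℝ × ℝ)) := by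
  rintro ⟨x, y⟩ ⟨u, v⟩ h
  simp only [Prod.mk.injEq] at h
  obtain ⟨h₀, h₁⟩ := h
  have hx := Real.exp_pos x
  have hy := Real.exp_pos y
  have hu := Real.exp_pos u
  have hv := Real.exp_pos v
  have e₀ := Real.log_injOn_pos (Set.mem_Ioi.mpr (by positivity))
    (Set.mem_Ioi.mpr (by positivity)) h₀
  have e₁ := Real.log_injOn_pos (Set.mem_Ioi.mpr (by positivity))
    (Set.mem_Ioi.mpr (by positivity)) h₁
  rw [div_eq_div_iff (by positivity) (by positivity)] at e₀ e₁
  have hD : 0 < θ ^ 2 * Real.exp x + θ * Real.exp y + 1 := by positivity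
  obtain ⟨D, hDx⟩ : ∃ D, D = θ ^ 2 * Real.exp x + θ * Real.exp y + 1 := ⟨_, rfl⟩
  obtain ⟨E, hEu⟩ : ∃ E, E = θ ^ 2 * Real.exp u + θ * Real.exp v + 1 := ⟨_, rfl⟩
  rw [← hDx, ← hEu] at e₀ e₁
  rw [← hDx] at hD
  have hθ2 : 1 - θ ^ 2 ≠ 0 := by
    rw [show 1 - θ ^ 2 = (1 - θ) * (1 + θ) by ring]
    exact mul_ne_zero (sub_ne_zero.mpr hθ1.symm) (by positivity)
  obtain ⟨ha, hb, hc⟩ := sos_kernel_trivial (a := E * Real.exp x - D * Real.exp u)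
    (b := E * Real.exp y - D * Real.exp v) (c := E - D) hθ2
    (by linear_combination e₀) (by linear_combination e₁)
    (by linear_combination D * hEu - E * hDx)
  obtain rfl : E = D := sub_eq_zero.mp hc
  rw [← mul_sub] at ha hb
  have hxu := sub_eq_zero.mp ((mul_eq_zero.mp ha).resolve_left hD.ne')
  have hyv := sub_eq_zero.mp ((mul_eq_zero.mp hb).resolve_left hD.ne')
  rw [Real.exp_injective hxu, Real.exp_injective hyv]
end

section
/- Let k ≥ 1 be an integer and 0 < θ ≤ 1 a real number. Suppose the positive real numbers z₀, z₁, t₀, t₁ satisfy z₀ = ((t₀ + θt₁ + θ²)/(θ²t₀ + θt₁ + 1))^k, z₁ = ((θt₀ + t₁ + θ)/(θ²t₀ + θt₁ + 1))^k, t₀ = ((z₀ + θz₁ + θ²)/(θ²z₀ + θz₁ + 1))^k, and t₁ = ((θz₀ + z₁ + θ)/(θ²z₀ + θz₁ + 1))^k. Then z₀ = t₀ and z₁ = t₁. -/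
/-- The transfer matrix `θ ^ |i - j|` of the three-state SOS model, applied to a vector. -/
def sosTransfer (θ : ℝ) (v : Fin 3 → ℝ) : Fin 3 → ℝ :=
  ![v 0 + θ * v 1 + θ ^ 2 * v 2, θ * v 0 + v 1 + θ * v 2, θ ^ 2 * v 0 + θ * v 1 + v 2]

theorem sosTransfer_sub_smul (θ c : ℝ) (v w : Fin 3 → ℝ) (i : Fin 3) :
    sosTransfer θ (v - c • w) i = sosTransfer θ v i - c * sosTransfer θ w i := by
  fin_cases i <;> simp [sosTransfer] <;> ring

theorem sosTransfer_pos {θ : ℝ} (hθ : 0 < θ) {v : Fin 3 → ℝ} (hv : ∀ i, 0 < v i) (i : Fin 3) :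
    0 < sosTransfer θ v i := by
  have h0 := hv 0
  have h1 := hv 1
  have h2 := hv 2
  fin_cases i <;> simp [sosTransfer] <;> positivity

/-- The inverse of the transfer matrix has nonpositive off-diagonal entries. -/
theorem nonneg_of_sosTransfer_nonpos {θ : ℝ} (hθ0 : 0 < θ) (hθ1 : θ < 1) {d : Fin 3 → ℝ}
    (hd : ∀ j, sosTransfer θ d j ≤ 0) {i : Fin 3} (hi : sosTransfer θ d i = 0) : 0 ≤ d i := by
  have hpos : 0 < 1 - θ ^ 2 := by nlinarith
  have h0 := mul_nonneg hθ0.le (neg_nonneg.mpr (hd 0))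
  have h1 := mul_nonneg hθ0.le (neg_nonneg.mpr (hd 1))
  have h2 := mul_nonneg hθ0.le (neg_nonneg.mpr (hd 2))
  refine nonneg_of_mul_nonneg_right (?_ : 0 ≤ (1 - θ ^ 2) * d i) hpos
  fin_cases i <;> simp [sosTransfer] at hi h0 h1 h2 ⊢
  · linear_combination h1 - hi
  · linear_combination h0 + h2 - (1 + θ ^ 2) * hi
  · linear_combination h1 - hi

theorem exists_max_ratio_sosTransfer {θ : ℝ} (hθ0 : 0 < θ) (hθ1 : θ < 1) {z t : Fin 3 → ℝ}
    (ht : ∀ i, 0 < t i) :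
    ∃ i, (∀ j, sosTransfer θ z j / sosTransfer θ t j ≤ sosTransfer θ z i / sosTransfer θ t i) ∧
      sosTransfer θ z i / sosTransfer θ t i ≤ z i / t i := by
  obtain ⟨i, hi⟩ := Finite.exists_max fun j => sosTransfer θ z j / sosTransfer θ t j
  refine ⟨i, hi, ?_⟩
  have hb := sosTransfer_pos hθ0 ht
  rw [le_div_iff₀ (ht i)]
  have key : 0 ≤ (z - (sosTransfer θ z i / sosTransfer θ t i) • t) i := by
    refine nonneg_of_sosTransfer_nonpos hθ0 hθ1 (fun j => ?_) ?_
    · rw [sosTransfer_sub_smul, sub_nonpos]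
      exact (div_le_iff₀ (hb j)).mp (hi j)
    · rw [sosTransfer_sub_smul, div_mul_cancel₀ _ (hb i).ne', sub_self]
  simpa using key

theorem sosTransfer_ratio_const {θ : ℝ} (hθ0 : 0 < θ) (hθ1 : θ < 1) {z t : Fin 3 → ℝ}
    (hz : ∀ i, 0 < z i) (ht : ∀ i, 0 < t i) (k : ℕ)
    (ezt : ∀ i, z i = (sosTransfer θ t i / sosTransfer θ t 2) ^ k)
    (etz : ∀ i, t i = (sosTransfer θ z i / sosTransfer θ z 2) ^ k) (i j : Fin 3) :
    sosTransfer θ z i / sosTransfer θ t i = sosTransfer θ z j / sosTransfer θ t j := by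
  have ha := sosTransfer_pos hθ0 hz
  have hb := sosTransfer_pos hθ0 ht
  obtain ⟨m, hm, hmr⟩ := exists_max_ratio_sosTransfer hθ0 hθ1 (z := z) ht
  obtain ⟨n, hn, hnr⟩ := exists_max_ratio_sosTransfer hθ0 hθ1 (z := t) hz
  have hmin : ∀ l, sosTransfer θ z n / sosTransfer θ t n ≤
      sosTransfer θ z l / sosTransfer θ t l := fun l => by
    simpa using inv_anti₀ (div_pos (hb l) (ha l)) (hn l)
  have hnr' : z n / t n ≤ sosTransfer θ z n / sosTransfer θ t n := by
    simpa using inv_anti₀ (div_pos (hb n) (ha n)) hnr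
  have hr : ∀ l, z l / t l * (sosTransfer θ z l / sosTransfer θ t l) ^ k =
      (sosTransfer θ z 2 / sosTransfer θ t 2) ^ k := fun l => by
    have h1 := (ha l).ne'
    have h2 := (hb l).ne'
    rw [ezt l, etz l, ← div_pow, ← mul_pow]
    congr 1
    have h3 := (ha 2).ne'
    have h4 := (hb 2).ne'
    field_simp
  have hmn : sosTransfer θ z m / sosTransfer θ t m ≤ sosTransfer θ z n / sosTransfer θ t n := by
    by_contra! hlt
    have hwn := div_pos (ha n) (hb n)
    have hlt' : z n / t n < z m / t m := by linarith
    have hpow := pow_le_pow_left₀ hwn.le hlt.le k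
    have := mul_lt_mul hlt' hpow (pow_pos hwn k) (div_pos (hz m) (ht m)).le
    rw [hr, hr] at this
    exact lt_irrefl _ this
  linarith [hm i, hm j, hmin i, hmin j]

/-- In the ferromagnetic case (0 < θ ≤ 1), the period-two system forces
z₀ = t₀ and z₁ = t₁. -/
theorem sos_period_two_FM (k : ℕ) (hk : 1 ≤ k) (θ : ℝ) (hθ0 : 0 < θ) (hθ1 : θ ≤ 1)
    (z₀ z₁ t₀ t₁ : ℝ) (hz0 : 0 < z₀) (hz1 : 0 < z₁) (ht0 : 0 < t₀) (ht1 : 0 < t₁)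
    (e1 : z₀ = ((t₀ + θ * t₁ + θ ^ 2) / (θ ^ 2 * t₀ + θ * t₁ + 1)) ^ k)
    (e2 : z₁ = ((θ * t₀ + t₁ + θ) / (θ ^ 2 * t₀ + θ * t₁ + 1)) ^ k)
    (e3 : t₀ = ((z₀ + θ * z₁ + θ ^ 2) / (θ ^ 2 * z₀ + θ * z₁ + 1)) ^ k)
    (e4 : t₁ = ((θ * z₀ + z₁ + θ) / (θ ^ 2 * z₀ + θ * z₁ + 1)) ^ k) :
    z₀ = t₀ ∧ z₁ = t₁ := by
  rcases hθ1.eq_or_lt with rfl | hθ1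
  · have h1 : t₀ + t₁ + 1 ≠ 0 := by positivity
    have h2 : z₀ + z₁ + 1 ≠ 0 := by positivity
    simp only [one_mul, one_pow, div_self h1, div_self h2] at e1 e2 e3 e4
    exact ⟨e1.trans e3.symm, e2.trans e4.symm⟩
  let z : Fin 3 → ℝ := ![z₀, z₁, 1]
  let t : Fin 3 → ℝ := ![t₀, t₁, 1]
  have hz : ∀ i, 0 < z i := by simp [Fin.forall_fin_succ, z, hz0, hz1]
  have ht : ∀ i, 0 < t i := by simp [Fin.forall_fin_succ, t, ht0, ht1]
  have ha := sosTransfer_pos hθ0 hz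
  have hb := sosTransfer_pos hθ0 ht
  have ezt : ∀ i, z i = (sosTransfer θ t i / sosTransfer θ t 2) ^ k := by
    intro i
    fin_cases i
    · simpa [sosTransfer, z, t] using e1
    · simpa [sosTransfer, z, t] using e2
    · simp [div_self (hb 2).ne', z]
  have etz : ∀ i, t i = (sosTransfer θ z i / sosTransfer θ z 2) ^ k := by
    intro i
    fin_cases i
    · simpa [sosTransfer, z, t] using e3
    · simpa [sosTransfer, z, t] using e4
    · simp [div_self (ha 2).ne', t]
  have hzt : ∀ i, z i = t i := fun i => by
    rw [ezt, etz]
    congr 1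
    have h := sosTransfer_ratio_const hθ0 hθ1 hz ht k ezt etz i 2
    rw [div_eq_div_iff (hb i).ne' (hb 2).ne'] at h
    rw [div_eq_div_iff (hb 2).ne' (ha 2).ne']
    linarith
  exact ⟨hzt 0, hzt 1⟩
end

section
/- Let k ≥ 1 be an integer and θ > 1 a real number. Then the equation z = ((2θ + z)/(θ² + θz + 1))^k has exactly one solution z > 0. -/
/-- For `θ > 1` the map `x ↦ (2θ + x) / (θ² + θx + 1)` is strictly decreasing on `[0, ∞)`. -/
theorem strictAntiOn_sos_ratio {θ : ℝ} (hθ : 1 < θ) :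
    StrictAntiOn (fun x : ℝ => (2 * θ + x) / (θ ^ 2 + θ * x + 1)) (Set.Ici 0) := by
  intro x hx y hy hxy
  have hx : 0 ≤ x := hx
  have hy : 0 ≤ y := hy
  have hθ₀ : 0 < θ := by linarith
  have hdx : 0 < θ ^ 2 + θ * x + 1 := by positivity
  have hdy : 0 < θ ^ 2 + θ * y + 1 := by positivity
  have hprod : 0 < (y - x) * (θ ^ 2 - 1) := mul_pos (by linarith) (by nlinarith)
  refine (div_lt_div_iff₀ hdy hdx).2 ?_
  linarith

theorem strictAntiOn_sos_ratio_pow {k : ℕ} (hk : 1 ≤ k) {θ : ℝ} (hθ : 1 < θ) :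
    StrictAntiOn (fun x : ℝ => ((2 * θ + x) / (θ ^ 2 + θ * x + 1)) ^ k) (Set.Ici 0) := by
  intro x hx y hy hxy
  have hy₀ : 0 ≤ y := hy
  have hθ₀ : 0 < θ := by linarith
  exact pow_lt_pow_left₀ (strictAntiOn_sos_ratio hθ hx hy hxy) (by positivity) (by omega)

/-- For θ > 1 the equation z = ((2θ+z)/(θ²+θz+1))^k has exactly one positive solution. -/
theorem sos_unique_fixed_point_AFM (k : ℕ) (hk : 1 ≤ k) (θ : ℝ) (hθ : 1 < θ) :
    ∃! z : ℝ, 0 < z ∧ z = ((2 * θ + z) / (θ ^ 2 + θ * z + 1)) ^ k := by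
  have hθ₀ : 0 < θ := by linarith
  have hanti := strictAntiOn_sos_ratio_pow hk hθ
  set ψ : ℝ → ℝ := fun x => ((2 * θ + x) / (θ ^ 2 + θ * x + 1)) ^ k with hψ
  have hpos : ∀ x, 0 ≤ x → 0 < ψ x := fun x hx => by
    simp only [hψ]
    positivity
  have hcont : ContinuousOn (fun x => x - ψ x) (Set.Icc 0 (ψ 0)) := by
    refine continuousOn_id.sub (ContinuousOn.pow (ContinuousOn.div ?_ ?_ ?_) k)
    · fun_prop
    · fun_prop
    · intro x hx
      have hx₀ : 0 ≤ x := hx.1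
      positivity
  have hψ₀ := hpos 0 le_rfl
  have hle : ψ (ψ 0) ≤ ψ 0 := hanti.antitoneOn Set.self_mem_Ici hψ₀.le hψ₀.le
  obtain ⟨z, hz, hfix⟩ := intermediate_value_Icc hψ₀.le hcont
    (show (0 : ℝ) ∈ Set.Icc (0 - ψ 0) (ψ 0 - ψ (ψ 0)) from ⟨by linarith, by linarith⟩)
  have hfix : z = ψ z := sub_eq_zero.1 hfix
  refine ⟨z, ⟨hfix ▸ hpos z hz.1, hfix⟩, ?_⟩
  rintro w ⟨hw, hwfix⟩
  have hwfix : w = ψ w := hwfix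
  rcases lt_trichotomy w z with h | h | h
  · have := hanti hw.le hz.1 h
    linarith
  · exact h
  · have := hanti hz.1 hw.le h
    linarith
end

section
/- Let k ≥ 1 be an integer and θ > 1 a real number, and let z* be the unique positive solution of z = ((2θ + z)/(θ² + θz + 1))^k. If k·z*·(θ² − 1) / ((2θ + z*)·(1 + θ² + θz*)) > 1, then there exist positive real numbers z₋* < z* < z₊* with ψ(z₊*,θ,k) = z₋* and ψ(z₋*,θ,k) = z₊*, where ψ(x,θ,k) = ((2θ + x)/(1 + θ² + θx))^k; in particular the system z = ψ(t,θ,k), t = ψ(z,θ,k) has at least three positive solutions (z₋*, z₊*), (z*, z*), (z₊*, z₋*). -/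
open Set Filter Topology

/-- A function with positive derivative at a zero takes negative values at points
arbitrarily close on the left. -/
theorem exists_mem_Ioo_neg_of_hasDerivAt_pos {g : ℝ → ℝ} {a z c : ℝ} (haz : a < z)
    (hg : HasDerivAt g c z) (hc : 0 < c) (hgz : g z = 0) : ∃ x ∈ Ioo a z, g x < 0 := by
  have hslope : ∀ᶠ x in 𝓝[<] z, 0 < slope g z x :=
    ((hasDerivAt_iff_tendsto_slope.1 hg).eventually (lt_mem_nhds hc)).filter_mono
      (nhdsWithin_mono z fun _ hx => ne_of_lt hx)
  obtain ⟨x, hx, hxa⟩ := (hslope.and (Ioo_mem_nhdsLT haz)).exists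
  refine ⟨x, hxa, ?_⟩
  rw [slope_def_field, hgz, sub_zero] at hx
  by_contra! h
  exact hx.not_ge (div_nonpos_of_nonneg_of_nonpos h (sub_nonpos.2 hxa.2.le))

/-- A positive, decreasing self-map of the half-line has a period-two orbit around any
fixed point at which its derivative is less than `-1`. -/
theorem exists_period_two_of_deriv_lt_neg_one {f : ℝ → ℝ} {z c : ℝ} (hz : 0 < z)
    (hcont : ContinuousOn f (Ici 0)) (hanti : StrictAntiOn f (Ici 0))
    (hpos : ∀ x, 0 ≤ x → 0 < f x) (hfix : f z = z) (hderiv : HasDerivAt f c z) (hc : c < -1) :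
    ∃ x y, 0 < x ∧ x < z ∧ z < y ∧ f y = x ∧ f x = y := by
  have hmaps : MapsTo f (Ici 0) (Ici 0) := fun x hx => (hpos x hx).le
  have hff : HasDerivAt (fun x => f (f x) - x) (c * c - 1) z :=
    (HasDerivAt.comp z (by rwa [hfix]) hderiv).sub (hasDerivAt_id z)
  obtain ⟨a, ⟨ha0, haz⟩, ha⟩ :=
    exists_mem_Ioo_neg_of_hasDerivAt_pos hz hff (by nlinarith) (by simp [hfix])
  have hgcont : ContinuousOn (fun x => f (f x) - x) (Icc 0 a) :=
    ((hcont.comp hcont hmaps).sub continuousOn_id).mono Icc_subset_Ici_self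
  have h0 : 0 < f (f 0) - 0 := by
    simpa using hpos _ (hpos 0 le_rfl).le
  obtain ⟨x, ⟨hx0, hxa⟩, hx⟩ := intermediate_value_Ioo' ha0.le hgcont ⟨ha, h0⟩
  have hxz : x < z := hxa.trans haz
  refine ⟨x, f x, hx0, hxz, ?_, sub_eq_zero.1 hx, rfl⟩
  simpa [hfix] using hanti (mem_Ici.2 hx0.le) (mem_Ici.2 hz.le) hxz


/-- If the unique positive fixed point z* of ψ is unstable (condition (4.14)), then
there exist z₋* < z* < z₊* with ψ(z₊*) = z₋* and ψ(z₋*) = z₊*; in particular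
the period-two system has at least the three positive solutions
(z₋*, z₊*), (z*, z*), (z₊*, z₋*). -/
theorem sos_period_two_AFM (k : ℕ) (hk : 1 ≤ k) (θ : ℝ) (hθ : 1 < θ)
    (zstar : ℝ) (hz : 0 < zstar)
    (hfix : zstar = ((2 * θ + zstar) / (θ ^ 2 + θ * zstar + 1)) ^ k)
    (huniq : ∀ w : ℝ, 0 < w → w = ((2 * θ + w) / (θ ^ 2 + θ * w + 1)) ^ k → w = zstar)
    (hcond : 1 < (k : ℝ) * zstar * (θ ^ 2 - 1) /
      ((2 * θ + zstar) * (1 + θ ^ 2 + θ * zstar))) :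
    ∃ zm zp : ℝ, 0 < zm ∧ zm < zstar ∧ zstar < zp ∧
      ((2 * θ + zp) / (1 + θ ^ 2 + θ * zp)) ^ k = zm ∧
      ((2 * θ + zm) / (1 + θ ^ 2 + θ * zm)) ^ k = zp := by
  rw [add_right_comm (θ ^ 2), add_comm (θ ^ 2) 1] at hfix
  have hden : ∀ x : ℝ, 0 ≤ x → 0 < 1 + θ ^ 2 + θ * x := fun x hx => by positivity
  have hnum : ∀ x : ℝ, 0 ≤ x → 0 < 2 * θ + x := fun x hx => by positivity
  have hk0 : k ≠ 0 := by lia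
  have hd := hden zstar hz.le
  have hn := hnum zstar hz.le
  have hderiv : HasDerivAt (fun x : ℝ => ((2 * θ + x) / (1 + θ ^ 2 + θ * x)) ^ k)
      (-((k : ℝ) * zstar * (θ ^ 2 - 1) /
        ((2 * θ + zstar) * (1 + θ ^ 2 + θ * zstar)))) zstar := by
    have h := ((((hasDerivAt_id zstar).const_add (2 * θ)).div
      (((hasDerivAt_id zstar).const_mul θ).const_add (1 + θ ^ 2)) hd.ne').pow k)
    refine h.congr_deriv ?_
    obtain ⟨j, rfl⟩ := Nat.exists_eq_succ_of_ne_zero hk0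
    have hz' : zstar = ((2 * θ + zstar) / (1 + θ ^ 2 + θ * zstar)) ^ j *
        ((2 * θ + zstar) / (1 + θ ^ 2 + θ * zstar)) := by rw [← pow_succ]; exact hfix
    simp only [id, Nat.succ_eq_add_one, Nat.add_sub_cancel, Pi.div_apply]
    rw [mul_assoc ((j + 1 : ℕ) : ℝ) zstar]
    generalize hp : ((2 * θ + zstar) / (1 + θ ^ 2 + θ * zstar)) ^ j = p at hz' ⊢
    have hzd : zstar * (1 + θ ^ 2 + θ * zstar) = p * (2 * θ + zstar) := by
      field_simp at hz'
      linarith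
    field_simp
    linear_combination (θ ^ 2 - 1) * hzd
  refine exists_period_two_of_deriv_lt_neg_one hz ?_ ?_ ?_ hfix.symm hderiv (neg_lt_neg hcond)
  · exact (ContinuousOn.div (by fun_prop) (by fun_prop) fun x hx => (hden x hx).ne').pow k
  · intro x hx y hy hxy
    have hx' := hden x hx
    have hy' := hden y hy
    have hy'' := hnum y hy
    refine pow_lt_pow_left₀ ?_ (by positivity) hk0
    rw [div_lt_div_iff₀ hy' hx']
    nlinarith [mul_pos (sub_pos.2 hxy) (show 0 < θ ^ 2 - 1 by nlinarith)]
  · intro x hx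
    exact pow_pos (div_pos (hnum x hx) (hden x hx)) k
end

section
/- Let θ > 0. For every (h₀,h₁) ∈ ℝ², each of the four partial derivatives ∂F₀/∂h₀, ∂F₀/∂h₁, ∂F₁/∂h₀, ∂F₁/∂h₁ evaluated at (h₀,h₁) is bounded in absolute value by |θ² − 1|/θ². -/
/-- The derivative of `log` of a Möbius map composed with `exp`. -/
theorem deriv_log_mobius_exp {a b c d s : ℝ} (hN : a * Real.exp s + b ≠ 0)
    (hD : c * Real.exp s + d ≠ 0) :
    deriv (fun t : ℝ => Real.log ((a * Real.exp t + b) / (c * Real.exp t + d))) s =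
      (a * d - b * c) * Real.exp s / ((a * Real.exp s + b) * (c * Real.exp s + d)) := by
  have h1 := ((Real.hasDerivAt_exp s).const_mul a).add_const b
  have h2 := ((Real.hasDerivAt_exp s).const_mul c).add_const d
  rw [((h1.fun_div h2 hD).log (div_ne_zero hN hD)).deriv]
  field_simp
  ring

theorem abs_deriv_log_mobius_exp_le {a b c d s k M : ℝ} {f : ℝ → ℝ}
    (hf : ∀ t, f t = Real.log ((a * Real.exp t + b) / (c * Real.exp t + d)))
    (hN : 0 < a * Real.exp s + b) (hD : 0 < c * Real.exp s + d) (hk : 0 < k)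
    (h : k * (|a * d - b * c| * Real.exp s) ≤
      M * ((a * Real.exp s + b) * (c * Real.exp s + d))) :
    |deriv f s| ≤ M / k := by
  rw [funext hf, deriv_log_mobius_exp hN.ne' hD.ne', abs_div, abs_mul, Real.abs_exp,
    abs_of_pos (mul_pos hN hD), div_le_div_iff₀ (mul_pos hN hD) hk]
  linarith

/-- All four partial derivatives of F = (F₀,F₁) are bounded in absolute value
by |θ² − 1|/θ². -/
theorem sos_F_derivative_bounds (θ : ℝ) (hθ : 0 < θ) (h₀ h₁ : ℝ) :
    |deriv (fun t : ℝ => Real.log ((Real.exp t + θ * Real.exp h₁ + θ ^ 2) /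
        (θ ^ 2 * Real.exp t + θ * Real.exp h₁ + 1))) h₀| ≤ |θ ^ 2 - 1| / θ ^ 2 ∧
    |deriv (fun t : ℝ => Real.log ((Real.exp h₀ + θ * Real.exp t + θ ^ 2) /
        (θ ^ 2 * Real.exp h₀ + θ * Real.exp t + 1))) h₁| ≤ |θ ^ 2 - 1| / θ ^ 2 ∧
    |deriv (fun t : ℝ => Real.log ((θ * Real.exp t + Real.exp h₁ + θ) /
        (θ ^ 2 * Real.exp t + θ * Real.exp h₁ + 1))) h₀| ≤ |θ ^ 2 - 1| / θ ^ 2 ∧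
    |deriv (fun t : ℝ => Real.log ((θ * Real.exp h₀ + Real.exp t + θ) /
        (θ ^ 2 * Real.exp h₀ + θ * Real.exp t + 1))) h₁| ≤ |θ ^ 2 - 1| / θ ^ 2 := by
  have hx := Real.exp_pos h₀
  have hy := Real.exp_pos h₁
  have hk : 0 < θ ^ 2 := by positivity
  refine ⟨abs_deriv_log_mobius_exp_le (a := 1) (b := θ * Real.exp h₁ + θ ^ 2) (c := θ ^ 2)
      (d := θ * Real.exp h₁ + 1) (fun t => by ring_nf) (by positivity) (by positivity) hk ?_,
    abs_deriv_log_mobius_exp_le (a := θ) (b := Real.exp h₀ + θ ^ 2) (c := θ)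
      (d := θ ^ 2 * Real.exp h₀ + 1) (fun t => by ring_nf) (by positivity) (by positivity) hk ?_,
    abs_deriv_log_mobius_exp_le (a := θ) (b := Real.exp h₁ + θ) (c := θ ^ 2)
      (d := θ * Real.exp h₁ + 1) (fun t => by ring_nf) (by positivity) (by positivity) hk ?_,
    abs_deriv_log_mobius_exp_le (a := 1) (b := θ * Real.exp h₀ + θ) (c := θ)
      (d := θ ^ 2 * Real.exp h₀ + 1) (fun t => by ring_nf) (by positivity) (by positivity) hk ?_⟩
  all_goals
    generalize Real.exp h₀ = x at *
    generalize Real.exp h₁ = y at *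
  · rw [show 1 * (θ * y + 1) - (θ * y + θ ^ 2) * θ ^ 2 = -((θ ^ 2 - 1) * (θ * y + 1 + θ ^ 2)) by
      ring, abs_neg, abs_mul, abs_of_pos (show 0 < θ * y + 1 + θ ^ 2 by positivity)]
    have key : θ ^ 2 * (θ * y + 1 + θ ^ 2) * x ≤
        (1 * x + (θ * y + θ ^ 2)) * (θ ^ 2 * x + (θ * y + 1)) := by
      rw [← sub_nonneg, show (1 * x + (θ * y + θ ^ 2)) * (θ ^ 2 * x + (θ * y + 1)) -
        θ ^ 2 * (θ * y + 1 + θ ^ 2) * x = θ ^ 2 * (x - 1) ^ 2 + θ ^ 2 * x + x * (θ * y + 1) +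
          θ * y * (θ * y + 1) + θ ^ 2 * (θ * y) by ring]
      positivity
    linarith [mul_le_mul_of_nonneg_left key (abs_nonneg (θ ^ 2 - 1))]
  · rw [show θ * (θ ^ 2 * x + 1) - (x + θ ^ 2) * θ = (θ ^ 2 - 1) * (θ * (x - 1)) by ring,
      abs_mul, abs_mul, abs_of_pos hθ]
    have hx1 : |x - 1| ≤ x + 1 := abs_le.2 ⟨by linarith, by linarith⟩
    have key : θ ^ 2 * (θ * |x - 1|) * y ≤
        (θ * y + (x + θ ^ 2)) * (θ * y + (θ ^ 2 * x + 1)) := by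
      calc θ ^ 2 * (θ * |x - 1|) * y ≤ θ ^ 2 * (θ * (x + 1)) * y := by gcongr
        _ ≤ _ := by
          rw [← sub_nonneg]
          ring_nf
          positivity
    linarith [mul_le_mul_of_nonneg_left key (abs_nonneg (θ ^ 2 - 1))]
  · rw [show θ * (θ * y + 1) - (y + θ) * θ ^ 2 = -((θ ^ 2 - 1) * θ) by ring, abs_neg,
      abs_mul, abs_of_pos hθ]
    have key : θ ^ 2 * θ * x ≤ (θ * x + (y + θ)) * (θ ^ 2 * x + (θ * y + 1)) := by
      rw [← sub_nonneg]
      ring_nf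
      positivity
    linarith [mul_le_mul_of_nonneg_left key (abs_nonneg (θ ^ 2 - 1))]
  · rw [show 1 * (θ ^ 2 * x + 1) - (θ * x + θ) * θ = -(θ ^ 2 - 1) by ring, abs_neg]
    have key : θ ^ 2 * y ≤ (1 * y + (θ * x + θ)) * (θ * y + (θ ^ 2 * x + 1)) := by
      rw [← sub_nonneg]
      ring_nf
      positivity
    linarith [mul_le_mul_of_nonneg_left key (abs_nonneg (θ ^ 2 - 1))]
end

section
/- Let θ > 0. For all h = (h₀,h₁) ∈ ℝ² and l = (l₀,l₁) ∈ ℝ², one has ‖F(h) − F(l)‖ ≤ (2|θ² − 1|/θ²)·‖h − l‖, where ‖(a,b)‖ = max(|a|, |b|) denotes the sup norm on ℝ². -/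
/-- The derivative of `t ↦ log (a eˣ⁽ᵗ⁾ + b eʸ⁽ᵗ⁾ + c)` along an affine path. -/
lemma hasDerivAt_log_affine_exp {a b c : ℝ} (ha : 0 < a) (hb : 0 < b) (hc : 0 < c)
    (l₀ l₁ u v t : ℝ) :
    HasDerivAt
      (fun t => Real.log (a * Real.exp (l₀ + t * u) + b * Real.exp (l₁ + t * v) + c))
      ((a * (Real.exp (l₀ + t * u) * u) + b * (Real.exp (l₁ + t * v) * v)) /
        (a * Real.exp (l₀ + t * u) + b * Real.exp (l₁ + t * v) + c)) t := by
  have hexp (p w : ℝ) :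
      HasDerivAt (fun t => Real.exp (p + t * w)) (Real.exp (p + t * w) * w) t := by
    simpa using (((hasDerivAt_id t).mul_const w).const_add p).exp
  exact ((((hexp l₀ u).const_mul a).add ((hexp l₁ v).const_mul b)).add_const c).log
    (show a * Real.exp (l₀ + t * u) + b * Real.exp (l₁ + t * v) + c ≠ 0 by positivity)

/-- A sup-norm Lipschitz bound for the logarithm of a ratio of positive affine functions of
`(eˣ, eʸ)`, from a pointwise bound on the `ℓ¹` norm of its gradient. -/
lemma abs_log_div_sub_log_div_le {a b c a' b' c' K : ℝ} (ha : 0 < a) (hb : 0 < b) (hc : 0 < c)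
    (ha' : 0 < a') (hb' : 0 < b') (hc' : 0 < c')
    (hK : ∀ x y : ℝ, 0 < x → 0 < y →
      |x * (a * (a' * x + b' * y + c') - a' * (a * x + b * y + c))| +
        |y * (b * (a' * x + b' * y + c') - b' * (a * x + b * y + c))| ≤
      K * ((a * x + b * y + c) * (a' * x + b' * y + c')))
    (h₀ h₁ l₀ l₁ : ℝ) :
    |Real.log ((a * Real.exp h₀ + b * Real.exp h₁ + c) /
          (a' * Real.exp h₀ + b' * Real.exp h₁ + c')) -
        Real.log ((a * Real.exp l₀ + b * Real.exp l₁ + c) /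
          (a' * Real.exp l₀ + b' * Real.exp l₁ + c'))| ≤
      K * max |h₀ - l₀| |h₁ - l₁| := by
  set u := h₀ - l₀ with hu
  set v := h₁ - l₁ with hv
  have hderiv (t : ℝ) := (hasDerivAt_log_affine_exp ha hb hc l₀ l₁ u v t).sub
    (hasDerivAt_log_affine_exp ha' hb' hc' l₀ l₁ u v t)
  have hmvt := norm_image_sub_le_of_norm_deriv_le_segment_01'
    (fun t _ => (hderiv t).hasDerivWithinAt) (C := K * max |u| |v|) (fun t _ => by
      have hx := Real.exp_pos (l₀ + t * u)
      have hy := Real.exp_pos (l₁ + t * v)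
      generalize Real.exp (l₀ + t * u) = x at hx ⊢
      generalize Real.exp (l₁ + t * v) = y at hy ⊢
      have hN : 0 < a * x + b * y + c := by positivity
      have hD : 0 < a' * x + b' * y + c' := by positivity
      have hbound := hK x y hx hy
      generalize hNe : a * x + b * y + c = N at *
      generalize hDe : a' * x + b' * y + c' = D at *
      rw [Real.norm_eq_abs, div_sub_div _ _ hN.ne' hD.ne', abs_div, abs_of_pos (mul_pos hN hD),
        div_le_iff₀ (mul_pos hN hD)]
      calc
        _ = |x * (a * D - a' * N) * u + y * (b * D - b' * N) * v| := by congr 1; ring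
        _ ≤ |x * (a * D - a' * N)| * |u| + |y * (b * D - b' * N)| * |v| := by
          rw [← abs_mul, ← abs_mul]; exact abs_add_le _ _
        _ ≤ |x * (a * D - a' * N)| * max |u| |v| + |y * (b * D - b' * N)| * max |u| |v| := by
          gcongr
          · exact le_max_left _ _
          · exact le_max_right _ _
        _ = (|x * (a * D - a' * N)| + |y * (b * D - b' * N)|) * max |u| |v| := by ring
        _ ≤ K * (N * D) * max |u| |v| := by gcongr
        _ = K * max |u| |v| * (N * D) := by ring)
  have hlog (p q : ℝ) := Real.log_div
    (show a * Real.exp p + b * Real.exp q + c ≠ 0 by positivity)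
    (show a' * Real.exp p + b' * Real.exp q + c' ≠ 0 by positivity)
  rw [hlog, hlog]
  simpa [hu, hv] using hmvt

/-- F is Lipschitz with constant 2|θ² − 1|/θ² in the sup norm on ℝ². -/
theorem sos_F_lipschitz (θ : ℝ) (hθ : 0 < θ) (h₀ h₁ l₀ l₁ : ℝ) :
    max |Real.log ((Real.exp h₀ + θ * Real.exp h₁ + θ ^ 2) /
          (θ ^ 2 * Real.exp h₀ + θ * Real.exp h₁ + 1)) -
         Real.log ((Real.exp l₀ + θ * Real.exp l₁ + θ ^ 2) /
          (θ ^ 2 * Real.exp l₀ + θ * Real.exp l₁ + 1))|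
        |Real.log ((θ * Real.exp h₀ + Real.exp h₁ + θ) /
          (θ ^ 2 * Real.exp h₀ + θ * Real.exp h₁ + 1)) -
         Real.log ((θ * Real.exp l₀ + Real.exp l₁ + θ) /
          (θ ^ 2 * Real.exp l₀ + θ * Real.exp l₁ + 1))|
      ≤ 2 * |θ ^ 2 - 1| / θ ^ 2 * max |h₀ - l₀| |h₁ - l₁| := by
  have hθ2 : 0 < θ ^ 2 := by positivity
  refine max_le ?_ ?_
  · have key := abs_log_div_sub_log_div_le (a := 1) (b := θ) (c := θ ^ 2) (a' := θ ^ 2) (b' := θ)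
      (c' := 1) (K := 2 * |θ ^ 2 - 1| / θ ^ 2) one_pos hθ hθ2 hθ2 hθ one_pos
      (fun x y hx hy => ?_) h₀ h₁ l₀ l₁
    · simpa only [one_mul] using key
    · rw [show x * (1 * (θ ^ 2 * x + θ * y + 1) - θ ^ 2 * (1 * x + θ * y + θ ^ 2)) =
          -((θ ^ 2 - 1) * (x * (θ * y + 1 + θ ^ 2))) by ring,
        show y * (θ * (θ ^ 2 * x + θ * y + 1) - θ * (1 * x + θ * y + θ ^ 2)) =
          (θ ^ 2 - 1) * (θ * y * (x - 1)) by ring,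
        abs_neg, abs_mul, abs_mul (θ ^ 2 - 1), abs_of_pos (by positivity : 0 < x * _),
        abs_mul (θ * y), abs_of_pos (mul_pos hθ hy), ← mul_add, mul_comm 2, mul_div_assoc,
        mul_assoc |θ ^ 2 - 1|]
      gcongr
      have habs : |x - 1| ≤ x + 1 := abs_le.mpr ⟨by linarith, by linarith⟩
      rw [div_mul_eq_mul_div, le_div_iff₀ hθ2]
      calc
        _ ≤ (x * (θ * y + 1 + θ ^ 2) + θ * y * (x + 1)) * θ ^ 2 := by gcongr
        _ ≤ _ := by
          have h1 : 0 ≤ x * (θ ^ 2 - 1) ^ 2 := by positivity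
          have h2 : 0 ≤ θ ^ 2 * x ^ 2 + θ * x * y + θ ^ 2 * y ^ 2 + θ * y + θ ^ 2 := by positivity
          have h3 : 0 ≤ θ ^ 3 * y + x + θ ^ 2 * x := by positivity
          linarith
  · have key := abs_log_div_sub_log_div_le (a := θ) (b := 1) (c := θ) (a' := θ ^ 2) (b' := θ)
      (c' := 1) (K := 2 * |θ ^ 2 - 1| / θ ^ 2) hθ one_pos hθ hθ2 hθ one_pos
      (fun x y hx hy => ?_) h₀ h₁ l₀ l₁
    · simpa only [one_mul] using key
    · rw [show x * (θ * (θ ^ 2 * x + θ * y + 1) - θ ^ 2 * (θ * x + 1 * y + θ)) =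
          -((θ ^ 2 - 1) * (θ * x)) by ring,
        show y * (1 * (θ ^ 2 * x + θ * y + 1) - θ * (θ * x + 1 * y + θ)) =
          -((θ ^ 2 - 1) * y) by ring,
        abs_neg, abs_neg, abs_mul, abs_mul (θ ^ 2 - 1), abs_of_pos (mul_pos hθ hx),
        abs_of_pos hy, ← mul_add, mul_comm 2, mul_div_assoc, mul_assoc |θ ^ 2 - 1|]
      gcongr
      rw [div_mul_eq_mul_div, le_div_iff₀ hθ2, ← sub_nonneg]
      ring_nf
      positivity
end

section
/- Let θ > 0. For all h = (0,h₁) ∈ ℝ² and l = (0,l₁) ∈ ℝ² (i.e. with vanishing first coordinate), one has ‖F(h) − F(l)‖ ≤ ( |θ² − 1| / (1 + 3θ² + 2θ·√(2(θ² + 1))) )·‖h − l‖, where ‖(a,b)‖ = max(|a|, |b|) denotes the sup norm on ℝ². -/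
/-- The nontrivial component of F along the line `h₀ = 0`. -/
noncomputable def sosRestricted (θ h : ℝ) : ℝ :=
  Real.log ((2 * θ + Real.exp h) / (θ ^ 2 + θ * Real.exp h + 1))

theorem hasDerivAt_sosRestricted {θ : ℝ} (hθ : 0 < θ) (h : ℝ) :
    HasDerivAt (sosRestricted θ)
      (Real.exp h * (1 - θ ^ 2) /
        ((2 * θ + Real.exp h) * (θ ^ 2 + θ * Real.exp h + 1))) h := by
  have hx := Real.exp_pos h
  have hnum : 2 * θ + Real.exp h ≠ 0 := by positivity
  have hden : θ ^ 2 + θ * Real.exp h + 1 ≠ 0 := by positivity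
  have dnum := (Real.hasDerivAt_exp h).const_add (2 * θ)
  have dden := (((Real.hasDerivAt_exp h).const_mul θ).const_add (θ ^ 2)).add_const 1
  refine ((dnum.fun_div dden hden).log (div_ne_zero hnum hden)).congr_deriv ?_
  field_simp
  ring

/-- The arithmetic-geometric mean inequality that gives the Lipschitz constant. -/
theorem sos_denominator_bound {θ x : ℝ} (hθ : 0 < θ) :
    x * (1 + 3 * θ ^ 2 + 2 * θ * Real.sqrt (2 * (θ ^ 2 + 1))) ≤
      (2 * θ + x) * (θ ^ 2 + θ * x + 1) := by
  have hs := Real.sq_sqrt (show 0 ≤ 2 * (θ ^ 2 + 1) by positivity)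
  have hsq := mul_nonneg hθ.le (sq_nonneg (x - Real.sqrt (2 * (θ ^ 2 + 1))))
  linear_combination hsq + θ * hs

theorem abs_sosRestricted_sub_le {θ : ℝ} (hθ : 0 < θ) (h l : ℝ) :
    |sosRestricted θ h - sosRestricted θ l| ≤
      |θ ^ 2 - 1| / (1 + 3 * θ ^ 2 + 2 * θ * Real.sqrt (2 * (θ ^ 2 + 1))) * |h - l| := by
  refine convex_univ.norm_image_sub_le_of_norm_hasDerivWithin_le
    (fun y _ => (hasDerivAt_sosRestricted hθ y).hasDerivWithinAt) (fun y _ => ?_)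
    (Set.mem_univ l) (Set.mem_univ h)
  have hy := Real.exp_pos y
  have hpos : 0 < (2 * θ + Real.exp y) * (θ ^ 2 + θ * Real.exp y + 1) := by positivity
  rw [Real.norm_eq_abs, abs_div, abs_mul, abs_of_pos hy, abs_of_pos hpos,
    abs_sub_comm 1, div_le_div_iff₀ hpos (by positivity)]
  calc _ = |θ ^ 2 - 1| *
        (Real.exp y * (1 + 3 * θ ^ 2 + 2 * θ * Real.sqrt (2 * (θ ^ 2 + 1)))) := by ring
    _ ≤ _ := mul_le_mul_of_nonneg_left (sos_denominator_bound hθ) (abs_nonneg _)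


/-- On vectors with vanishing first coordinate, F is Lipschitz with the improved
constant |θ² − 1|/(1 + 3θ² + 2θ√(2(θ² + 1))) in the sup norm on ℝ². -/
theorem sos_F_lipschitz_restricted (θ : ℝ) (hθ : 0 < θ) (h₁ l₁ : ℝ) :
    max |Real.log ((Real.exp (0:ℝ) + θ * Real.exp h₁ + θ ^ 2) /
          (θ ^ 2 * Real.exp (0:ℝ) + θ * Real.exp h₁ + 1)) -
         Real.log ((Real.exp (0:ℝ) + θ * Real.exp l₁ + θ ^ 2) /
          (θ ^ 2 * Real.exp (0:ℝ) + θ * Real.exp l₁ + 1))|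
        |Real.log ((θ * Real.exp (0:ℝ) + Real.exp h₁ + θ) /
          (θ ^ 2 * Real.exp (0:ℝ) + θ * Real.exp h₁ + 1)) -
         Real.log ((θ * Real.exp (0:ℝ) + Real.exp l₁ + θ) /
          (θ ^ 2 * Real.exp (0:ℝ) + θ * Real.exp l₁ + 1))|
      ≤ |θ ^ 2 - 1| / (1 + 3 * θ ^ 2 + 2 * θ * Real.sqrt (2 * (θ ^ 2 + 1))) *
          max |(0:ℝ) - 0| |h₁ - l₁| := by
  have first (x : ℝ) : Real.log ((Real.exp (0:ℝ) + θ * Real.exp x + θ ^ 2) /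
      (θ ^ 2 * Real.exp (0:ℝ) + θ * Real.exp x + 1)) = 0 := by
    have hx : θ ^ 2 + θ * Real.exp x + 1 ≠ 0 := by positivity
    rw [Real.exp_zero, mul_one,
      show 1 + θ * Real.exp x + θ ^ 2 = θ ^ 2 + θ * Real.exp x + 1 by ring,
      div_self hx, Real.log_one]
  have second (x : ℝ) : Real.log ((θ * Real.exp (0:ℝ) + Real.exp x + θ) /
      (θ ^ 2 * Real.exp (0:ℝ) + θ * Real.exp x + 1)) = sosRestricted θ x := by
    rw [sosRestricted, Real.exp_zero, mul_one, mul_one,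
      show θ + Real.exp x + θ = 2 * θ + Real.exp x by ring]
  rw [first, first, second, second, sub_self, abs_zero, max_eq_right (abs_nonneg _),
    max_eq_right (abs_nonneg _)]
  exact abs_sosRestricted_sub_le hθ h₁ l₁
end

section
/- Let θ > 0. For every (h₀,h₁) ∈ ℝ², one has |F₀(h₀,h₁)| ≤ ( |θ² − 1| / (θ² + 1) )·|h₀|. -/
/-- The derivative in `s` of `log ((eˢ + b + t) / (t * eˢ + b + 1))`. -/
theorem hasDerivAt_log_exp_ratio {t b : ℝ} (ht : 0 < t) (hb : 0 < b) (s : ℝ) :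
    HasDerivAt (fun s => Real.log ((Real.exp s + b + t) / (t * Real.exp s + b + 1)))
      ((1 - t) * (Real.exp s * (b + 1 + t) /
        ((Real.exp s + b + t) * (t * Real.exp s + b + 1)))) s := by
  have hx := Real.exp_pos s
  have hN : 0 < Real.exp s + b + t := by positivity
  have hD : 0 < t * Real.exp s + b + 1 := by positivity
  have hN' := ((Real.hasDerivAt_exp s).add_const b).add_const t
  have hD' := (((Real.hasDerivAt_exp s).const_mul t).add_const b).add_const 1
  refine ((hN'.fun_div hD' hD.ne').log (div_pos hN hD).ne').congr_deriv ?_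
  field_simp
  ring

/-- The key algebraic inequality bounding the derivative of the logarithmic ratio. -/
theorem mul_div_mul_le_inv_one_add {t b x : ℝ} (ht : 0 < t) (hb : 0 < b) (hx : 0 < x) :
    x * (b + 1 + t) / ((x + b + t) * (t * x + b + 1)) ≤ 1 / (t + 1) := by
  rw [div_le_div_iff₀ (by positivity) (by positivity)]
  nlinarith [mul_nonneg ht.le (sq_nonneg (x - 1)), mul_pos hb hb, mul_pos ht hb]

/-- The bound |F₀(h₀,h₁)| ≤ (|θ² − 1|/(θ² + 1))·|h₀|. -/
theorem sos_F0_bound (θ : ℝ) (hθ : 0 < θ) (h₀ h₁ : ℝ) :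
    |Real.log ((Real.exp h₀ + θ * Real.exp h₁ + θ ^ 2) /
        (θ ^ 2 * Real.exp h₀ + θ * Real.exp h₁ + 1))|
      ≤ |θ ^ 2 - 1| / (θ ^ 2 + 1) * |h₀| := by
  have ht : 0 < θ ^ 2 := by positivity
  have hb : 0 < θ * Real.exp h₁ := by positivity
  have key := convex_univ.norm_image_sub_le_of_norm_hasDerivWithin_le
    (C := |θ ^ 2 - 1| / (θ ^ 2 + 1)) (x := 0) (y := h₀)
    (fun s _ => (hasDerivAt_log_exp_ratio ht hb s).hasDerivWithinAt)
    (fun s _ => ?_) (Set.mem_univ _) (Set.mem_univ _)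
  · have h0 : (Real.exp 0 + θ * Real.exp h₁ + θ ^ 2) /
        (θ ^ 2 * Real.exp 0 + θ * Real.exp h₁ + 1) = 1 := by
      rw [Real.exp_zero, div_eq_one_iff_eq (by positivity)]
      ring
    simpa only [h0, Real.log_one, sub_zero, Real.norm_eq_abs] using key
  · have hx := Real.exp_pos s
    rw [Real.norm_eq_abs, abs_mul, abs_sub_comm, div_eq_mul_one_div |θ ^ 2 - 1|,
      abs_of_nonneg (a := _ / _) (by positivity)]
    exact mul_le_mul_of_nonneg_left (mul_div_mul_le_inv_one_add ht hb hx) (abs_nonneg _)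
end
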